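/- Let H be a finite-dimensional complex Hilbert space and let (f_1,…,f_n) be a frame for H. Then the sequence of iterates (Φ^m(f_1,…,f_n))_{m≥0} has a subsequence converging in H^n (equivalently, each coordinate converges in norm) to a limit (g_1,…,g_n) which is a zero extended orthonormal basis for span{f_1,…,f_n}; moreover, g_k = 0 if and only if f_k ∈ span{f_1,…,f_{k−1}}. -/

import Mathlib

open scoped ComplexInnerProductSpace
open Finset Filter

open scoped Classical in
/-- One step of the generalized Gram–Schmidt procedure (GGSP): step `k` uses the
input vector `fk = f k` and the current tuple `g` (whose entries at indices `< k`
have already been processed).  Here `⟪a, b⟫` is conjugate-linear in `a`, so the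
paper's `⟨f_k, g_j⟩` (conjugate-linear in the second slot) is `⟪g j, f k⟫`. -/
noncomputable def ggspStep {H : Type*} [NormedAddCommGroup H] [InnerProductSpace ℂ H]
    {n : ℕ} (k : Fin n) (fk : H) (g : Fin n → H) : Fin n → H :=
  if fk = 0 then Function.update g k 0
  else
    let u := fk - ∑ j ∈ Finset.univ.filter (fun j : Fin n => j < k), ⟪g j, fk⟫ • g j
    if u = 0 then
      fun i =>
        if i < k then
          g i + (((1 / ‖fk‖ ^ 2) * (1 / Real.sqrt (1 + ‖fk‖ ^ 2) - 1) : ℝ)) •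
            (⟪fk, g i⟫ • fk)
        else if i = k then (Real.sqrt (1 + ‖fk‖ ^ 2))⁻¹ • fk
        else g i
    else Function.update g k (‖u‖⁻¹ • u)

/-- The generalized Gram–Schmidt procedure `Φ` of Casazza--Kutyniok. -/
noncomputable def GGSP {H : Type*} [NormedAddCommGroup H] [InnerProductSpace ℂ H]
    {n : ℕ} (f : Fin n → H) : Fin n → H :=
  (List.finRange n).foldl (fun g k => ggspStep k (f k) g) f

/-- `(f i)₁ⁿ` is a frame for `H`. -/
def IsFrame {H : Type*} [NormedAddCommGroup H] [InnerProductSpace ℂ H]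
    {n : ℕ} (f : Fin n → H) : Prop :=
  ∃ A B : ℝ, 0 < A ∧ A ≤ B ∧ ∀ x : H,
    A * ‖x‖ ^ 2 ≤ ∑ i, ‖⟪x, f i⟫‖ ^ 2 ∧ ∑ i, ‖⟪x, f i⟫‖ ^ 2 ≤ B * ‖x‖ ^ 2

/-- `f` is a zero extended orthonormal basis for the subspace `W`: after removing the
zero vectors, the remaining vectors form an orthonormal basis of `W`. -/
def IsZeroExtONB {H : Type*} [NormedAddCommGroup H] [InnerProductSpace ℂ H]
    {n : ℕ} (W : Submodule ℂ H) (f : Fin n → H) : Prop :=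
  (∀ i, f i ≠ 0 → ‖f i‖ = 1) ∧ (∀ i j, i ≠ j → ⟪f i, f j⟫ = 0) ∧
    Submodule.span ℂ (Set.range f) = W

section GGSPaux

variable {H : Type*} [NormedAddCommGroup H] [InnerProductSpace ℂ H] {n : ℕ}

lemma gg_inner_self (x : H) : ⟪x, x⟫ = (‖x‖ : ℂ) ^ 2 := inner_self_eq_norm_sq_to_K x

/-- The linear map `x ↦ x + a ⟪v, x⟫ v`. -/
noncomputable def ggT (a : ℝ) (v : H) : H →ₗ[ℂ] H :=
  LinearMap.id + (a : ℂ) • (LinearMap.toSpanSingleton ℂ H v).comp (innerₛₗ ℂ v)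

lemma ggT_apply (a : ℝ) (v x : H) : ggT a v x = x + (a : ℂ) • (⟪v, x⟫ • v) := by
  simp [ggT]

lemma ggT_symm (a : ℝ) (v x y : H) : ⟪ggT a v x, y⟫ = ⟪x, ggT a v y⟫ := by
  simp only [ggT_apply, inner_add_left, inner_add_right, inner_smul_left, inner_smul_right,
    inner_conj_symm, Complex.conj_ofReal]
  ring

lemma ggT_sq (v x : H) (a c : ℝ) (h : 2 * a + a ^ 2 * ‖v‖ ^ 2 + c = 0) :
    ggT a v (ggT a v x) + (c : ℂ) • (⟪v, x⟫ • v) = x := by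
  have h' : 2 * (a : ℂ) + (a : ℂ) ^ 2 * (‖v‖ : ℂ) ^ 2 + c = 0 := by exact_mod_cast h
  simp only [ggT_apply, inner_add_right, inner_smul_right, gg_inner_self]
  have : x + (a : ℂ) • ⟪v, x⟫ • v +
      (a : ℂ) • (⟪v, x⟫ + (a : ℂ) * (⟪v, x⟫ * ((‖v‖ : ℂ)) ^ 2)) • v + (c : ℂ) • ⟪v, x⟫ • v
      = x + ((2 * (a : ℂ) + (a : ℂ) ^ 2 * (‖v‖ : ℂ) ^ 2 + c) * ⟪v, x⟫) • v := by module
  rw [h', zero_mul, zero_smul, add_zero] at this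
  exact this

lemma ggT_norm (v x : H) (a c : ℝ) (hc : 0 ≤ c) (h : 2 * a + a ^ 2 * ‖v‖ ^ 2 + c = 0) :
    ‖ggT a v x‖ ≤ ‖x‖ := by
  have h1 := ggT_sq v x a c h
  have h2 : ⟪x, ggT a v (ggT a v x) + (c : ℂ) • (⟪v, x⟫ • v)⟫ = ⟪x, x⟫ := by rw [h1]
  rw [inner_add_right, ← ggT_symm, inner_smul_right, inner_smul_right, gg_inner_self,
    gg_inner_self, ← inner_conj_symm x v, Complex.mul_conj'] at h2
  have h3 : ‖ggT a v x‖ ^ 2 + c * ‖⟪v, x⟫‖ ^ 2 = ‖x‖ ^ 2 := by exact_mod_cast h2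
  have h4 : 0 ≤ c * ‖⟪v, x⟫‖ ^ 2 := by positivity
  exact (sq_le_sq₀ (norm_nonneg _) (norm_nonneg _)).1 (by linarith)

/-- span of the first `k` vectors -/
noncomputable def ggW (f : Fin n → H) (k : ℕ) : Submodule ℂ H :=
  Submodule.span ℂ (f '' {j : Fin n | j.1 < k})

/-- Invariant of the procedure. -/
structure GGInv (f : Fin n → H) (k : ℕ) (g : Fin n → H) : Prop where
  mem : ∀ i : Fin n, i.1 < k → g i ∈ ggW f k
  recon : ∀ x ∈ ggW f k, ∑ i ∈ univ.filter (fun i : Fin n => i.1 < k), ⟪g i, x⟫ • g i = x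
  dep : ∀ i : Fin n, i.1 < k → f i ∈ ggW f i.1 → g i ∈ ggW g i.1
  nrm : ∀ i : Fin n, i.1 < k → f i ∈ ggW f i.1 →
    ‖g i‖ ^ 2 * (1 + ‖f i‖ ^ 2) ≤ ‖f i‖ ^ 2

lemma gg_filter_succ (k : Fin n) : univ.filter (fun i : Fin n => i.1 < k.1 + 1) =
    insert k (univ.filter (fun i : Fin n => i.1 < k.1)) := by
  ext i; simp [Fin.ext_iff]; omega

lemma ggW_mono (f : Fin n → H) {k l : ℕ} (h : k ≤ l) : ggW f k ≤ ggW f l :=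
  Submodule.span_mono (Set.image_mono fun _ hj => lt_of_lt_of_le hj h)

lemma ggW_mem (f : Fin n → H) {k : ℕ} (i : Fin n) (h : i.1 < k) : f i ∈ ggW f k :=
  Submodule.subset_span ⟨i, h, rfl⟩

lemma ggW_succ (f : Fin n → H) (k : Fin n) :
    ggW f (k.1 + 1) = ggW f k.1 ⊔ Submodule.span ℂ {f k} := by
  unfold ggW
  rw [← Submodule.span_union, ← Set.image_singleton, ← Set.image_union]
  congr 2
  ext i; simp [Fin.ext_iff]; omega

lemma ggW_congr {f g : Fin n → H} {k : ℕ} (h : ∀ i : Fin n, i.1 < k → f i = g i) :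
    ggW f k = ggW g k := by
  unfold ggW
  congr 1
  exact Set.image_congr fun i hi => h i hi

lemma ggW_map (T : H →ₗ[ℂ] H) {f g : Fin n → H} {k : ℕ}
    (h : ∀ i : Fin n, i.1 < k → g i = T (f i)) {x : H} (hx : x ∈ ggW f k) :
    T x ∈ ggW g k := by
  have : ggW f k ≤ (ggW g k).comap T := by
    refine Submodule.span_le.2 ?_
    rintro _ ⟨i, hi, rfl⟩
    show T (f i) ∈ ggW g k
    rw [← h i hi]
    exact ggW_mem g i hi
  exact this hx

lemma gginv_step (f g : Fin n → H) (k : Fin n) (h : GGInv f k.1 g) :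
    GGInv f (k.1 + 1) (ggspStep k (f k) g) := by
  have hlt : ∀ i : Fin n, i.1 < k.1 + 1 → i ≠ k → i.1 < k.1 := by
    intro i hi hne
    have : i.1 ≠ k.1 := fun e => hne (Fin.ext e)
    omega
  have hnek : ∀ i : Fin n, i.1 < k.1 → i ≠ k := by
    rintro i hi rfl; omega
  have hknot : k ∉ univ.filter (fun i : Fin n => i.1 < k.1) := by simp
  -- generic treatment of an update at `k`
  have upd : ∀ y : H, y ∈ ggW f (k.1 + 1) →
      (∀ x ∈ ggW f (k.1 + 1),
        ⟪y, x⟫ • y + ∑ i ∈ univ.filter (fun i : Fin n => i.1 < k.1), ⟪g i, x⟫ • g i = x) →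
      (f k ∈ ggW f k.1 → y = 0) → GGInv f (k.1 + 1) (Function.update g k y) := by
    intro y hy hrec h0
    have hu : ∀ i : Fin n, i.1 < k.1 → Function.update g k y i = g i := fun i hi =>
      Function.update_of_ne (hnek i hi) _ _
    refine ⟨?_, ?_, ?_, ?_⟩
    · intro i hi
      by_cases e : i = k
      · subst e; simpa using hy
      · rw [hu i (hlt i hi e)]
        exact ggW_mono f (Nat.le_succ _) (h.mem i (hlt i hi e))
    · intro x hx
      rw [gg_filter_succ, Finset.sum_insert hknot]
      conv_rhs => rw [← hrec x hx]
      simp only [Function.update_self]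
      congr 1
      refine Finset.sum_congr rfl fun i hi => ?_
      rw [hu i (by simpa using hi)]
    · intro i hi hd
      by_cases e : i = k
      · subst e; simp [h0 hd]
      · have hik := hlt i hi e
        rw [hu i hik, ggW_congr (g := g) fun j hj => hu j (hj.trans hik)]
        exact h.dep i hik hd
    · intro i hi hd
      by_cases e : i = k
      · subst e; simp [h0 hd]
      · rw [hu i (hlt i hi e)]
        exact h.nrm i (hlt i hi e) hd
  unfold ggspStep
  split_ifs with hz
  · -- `f k = 0`
    have hW : ggW f (k.1 + 1) = ggW f k.1 := by rw [ggW_succ, hz]; simp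
    refine upd 0 (Submodule.zero_mem _) ?_ fun _ => rfl
    intro x hx
    rw [hW] at hx
    simpa using h.recon x hx
  extract_lets u
  have hu : u = f k - ∑ j ∈ univ.filter (fun j : Fin n => j.1 < k.1), ⟪g j, f k⟫ • g j := rfl
  have hSmem : ∑ j ∈ univ.filter (fun j : Fin n => j.1 < k.1), ⟪g j, f k⟫ • g j ∈ ggW f k.1 :=
    Submodule.sum_mem _ fun j hj => Submodule.smul_mem _ _ (h.mem j (by simpa using hj))
  split_ifs with hu0
  · -- `f k` in the span of the previous ones
    have hfk : f k ∈ ggW f k.1 := by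
      rw [hu, sub_eq_zero] at hu0
      rw [hu0]; exact hSmem
    have hW : ggW f (k.1 + 1) = ggW f k.1 := by
      rw [ggW_succ, sup_eq_left, Submodule.span_singleton_le_iff_mem]; exact hfk
    set v := f k with hv
    set s : ℝ := 1 / Real.sqrt (1 + ‖v‖ ^ 2) with hs
    set a : ℝ := 1 / ‖v‖ ^ 2 * (s - 1) with ha
    have hF : 0 < ‖v‖ ^ 2 := by positivity
    have hs2 : s ^ 2 * (1 + ‖v‖ ^ 2) = 1 := by
      rw [hs, div_pow, Real.sq_sqrt (by positivity)]; field_simp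
    have hs0 : 0 < s := by positivity
    have haF : a * ‖v‖ ^ 2 = s - 1 := by rw [ha]; field_simp
    have hrel : 2 * a + a ^ 2 * ‖v‖ ^ 2 + s ^ 2 = 0 := by
      have : ‖v‖ ^ 2 * (2 * a + a ^ 2 * ‖v‖ ^ 2 + s ^ 2) = 0 := by
        linear_combination (2 + a * ‖v‖ ^ 2 + s - 1) * haF + hs2
      exact (mul_eq_zero.1 this).resolve_left hF.ne'
    set G : Fin n → H := fun i => if i < k then g i + a • (⟪v, g i⟫ • v)
        else if i = k then (Real.sqrt (1 + ‖v‖ ^ 2))⁻¹ • v else g i with hG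
    have G1 : ∀ i : Fin n, i.1 < k.1 → G i = ggT a v (g i) := by
      intro i hi
      have : i < k := hi
      simp only [hG, this, if_true, ggT_apply, Complex.coe_smul]
    have G2 : G k = (s : ℂ) • v := by
      simp only [hG, lt_irrefl, if_false, if_true, hs, one_div, Complex.coe_smul]
    have hTmem : ∀ x ∈ ggW f k.1, ggT a v x ∈ ggW f k.1 := by
      intro x hx
      rw [ggT_apply]
      exact Submodule.add_mem _ hx (Submodule.smul_mem _ _ (Submodule.smul_mem _ _ hfk))
    have hTv : ggT a v v = (s : ℂ) • v := by
      have h' : (a : ℂ) * (‖v‖ : ℂ) ^ 2 = s - 1 := by exact_mod_cast haF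
      rw [ggT_apply, gg_inner_self, smul_smul]
      rw [h']
      module
    refine ⟨?_, ?_, ?_, ?_⟩
    · intro i hi
      rw [hW]
      by_cases e : i = k
      · subst e; rw [G2]; exact Submodule.smul_mem _ _ hfk
      · rw [G1 i (hlt i hi e)]; exact hTmem _ (h.mem i (hlt i hi e))
    · intro x hx
      rw [hW] at hx
      rw [gg_filter_succ, Finset.sum_insert hknot]
      have e1 : ∑ i ∈ univ.filter (fun i : Fin n => i.1 < k.1), ⟪G i, x⟫ • G i
          = ggT a v (ggT a v x) := by
        conv_rhs => rw [← h.recon _ (hTmem x hx)]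
        rw [map_sum]
        refine Finset.sum_congr rfl fun i hi => ?_
        rw [G1 i (by simpa using hi), ggT_symm, map_smul]
      rw [e1, G2, add_comm]
      conv_rhs => rw [← ggT_sq v x a (s ^ 2) hrel]
      congr 1
      simp only [inner_smul_left, Complex.conj_ofReal, smul_smul]
      congr 1
      push_cast
      ring
    · intro i hi hd
      by_cases e : i = k
      · subst e
        rw [G2, ← hTv]
        refine ggW_map (ggT a v) (f := g) (fun j hj => G1 j hj) ?_
        rw [← h.recon v hfk]
        exact Submodule.sum_mem _ fun j hj =>
          Submodule.smul_mem _ _ (ggW_mem g j (by simpa using hj))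
      · have hik := hlt i hi e
        rw [G1 i hik]
        exact ggW_map (ggT a v) (fun j hj => G1 j (hj.trans hik)) (h.dep i hik hd)
    · intro i hi hd
      by_cases e : i = k
      · subst e
        rw [G2, norm_smul, mul_pow, ← hv]
        simp only [Complex.norm_real, Real.norm_eq_abs, sq_abs]
        apply le_of_eq
        linear_combination ‖v‖ ^ 2 * hs2
      · have hik := hlt i hi e
        rw [G1 i hik]
        refine le_trans ?_ (h.nrm i hik hd)
        have := ggT_norm v (g i) a (s ^ 2) (by positivity) hrel
        gcongr
  · -- new direction
    have hnot : f k ∉ ggW f k.1 := by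
      intro hm
      exact hu0 (by rw [hu, h.recon _ hm, sub_self])
    have horth : ∀ x ∈ ggW f k.1, ⟪x, u⟫ = 0 := by
      intro x hx
      have e : ⟪x, f k⟫ =
          ∑ j ∈ univ.filter (fun j : Fin n => j.1 < k.1), ⟪g j, f k⟫ * ⟪x, g j⟫ := by
        conv_lhs => rw [← h.recon x hx]
        rw [sum_inner]
        refine Finset.sum_congr rfl fun j _ => ?_
        rw [inner_smul_left, inner_conj_symm, mul_comm]
      rw [hu, inner_sub_right, e, inner_sum, sub_eq_zero]
      refine Finset.sum_congr rfl fun j _ => ?_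
      rw [inner_smul_right]
    have humem : u ∈ ggW f (k.1 + 1) :=
      Submodule.sub_mem _ (ggW_mem f k (Nat.lt_succ_self _))
        (ggW_mono f (Nat.le_succ _) hSmem)
    refine upd _ ?_ ?_ fun hm => absurd hm hnot
    · rw [← Complex.coe_smul]
      exact Submodule.smul_mem _ _ humem
    · intro x hx
      obtain ⟨w, c, hw, rfl⟩ : ∃ w : H, ∃ c : ℂ, w ∈ ggW f k.1 ∧ x = w + c • u := by
        rw [ggW_succ] at hx
        obtain ⟨w, hw, z, hz', rfl⟩ := Submodule.mem_sup.1 hx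
        obtain ⟨c, rfl⟩ := Submodule.mem_span_singleton.1 hz'
        refine ⟨w + c • (∑ j ∈ univ.filter (fun j : Fin n => j.1 < k.1), ⟪g j, f k⟫ • g j), c,
          Submodule.add_mem _ hw (Submodule.smul_mem _ _ hSmem), ?_⟩
        rw [hu]; module
      have e1 : ∑ i ∈ univ.filter (fun i : Fin n => i.1 < k.1), ⟪g i, w + c • u⟫ • g i = w := by
        conv_rhs => rw [← h.recon w hw]
        refine Finset.sum_congr rfl fun i hi => ?_
        rw [inner_add_right, inner_smul_right, horth _ (h.mem i (by simpa using hi))]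
        simp
      have e2 : ⟪u, w⟫ = 0 := by rw [← inner_conj_symm, horth w hw, map_zero]
      have hn : (‖u‖ : ℂ) ≠ 0 := by simpa using hu0
      rw [e1, ← Complex.coe_smul, inner_smul_left, inner_add_right, inner_smul_right, e2,
        gg_inner_self, Complex.conj_ofReal, smul_smul, add_comm]
      congr 2
      push_cast
      field_simp
      simp

lemma gginv_final (f : Fin n → H) : GGInv f n (GGSP f) := by
  have key : ∀ k, k ≤ n →
      GGInv f k (((List.finRange n).take k).foldl (fun g k => ggspStep k (f k) g) f) := by
    intro k
    induction k with
    | zero =>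
      intro _
      refine ⟨by simp, ?_, by simp, by simp⟩
      intro x hx
      simp [ggW] at hx
      simp [hx]
    | succ k ih =>
      intro hk
      have h1 := gginv_step f _ ⟨k, hk⟩ (ih (by omega))
      have h2 : (List.finRange n).take (k + 1) = (List.finRange n).take k ++ [⟨k, hk⟩] := by
        rw [List.take_add_one]
        congr 1
        rw [List.getElem?_eq_getElem (by simpa using hk)]
        simp
      rw [h2, List.foldl_append]
      exact h1
  have := key n le_rfl
  rwa [List.take_of_length_le (by simp)] at this

lemma ggW_top (f : Fin n → H) : ggW f n = Submodule.span ℂ (Set.range f) := by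
  unfold ggW
  congr 1
  ext x; simp

/-- Parseval frame (reconstruction form) -/
def GGPars (g : Fin n → H) : Prop := ∀ x, ∑ i, ⟪g i, x⟫ • g i = x

lemma gg_pars_of_span (f : Fin n → H) (h : Submodule.span ℂ (Set.range f) = ⊤) :
    GGPars (GGSP f) := by
  intro x
  have := (gginv_final f).recon x (by rw [ggW_top, h]; trivial)
  simpa using this

lemma GGPars.span {g : Fin n → H} (h : GGPars g) : Submodule.span ℂ (Set.range g) = ⊤ := by
  rw [eq_top_iff]
  intro x _
  rw [← h x]
  exact Submodule.sum_mem _ fun i _ => Submodule.smul_mem _ _ (Submodule.subset_span ⟨i, rfl⟩)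

lemma GGPars.norm_sq {g : Fin n → H} (h : GGPars g) (x : H) :
    ∑ i, ‖⟪g i, x⟫‖ ^ 2 = ‖x‖ ^ 2 := by
  have h1 : ⟪∑ i, ⟪g i, x⟫ • g i, x⟫ = ⟪x, x⟫ := by rw [h x]
  rw [sum_inner, gg_inner_self] at h1
  have h2 : ∀ i, ⟪⟪g i, x⟫ • g i, x⟫ = ((‖⟪g i, x⟫‖ ^ 2 : ℝ) : ℂ) := by
    intro i
    rw [inner_smul_left, Complex.conj_mul']
    push_cast; rfl
  simp only [h2] at h1
  exact_mod_cast h1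

lemma GGPars.sum_sq_index {g : Fin n → H} (h : GGPars g) (i : Fin n) :
    (‖g i‖ ^ 2) ^ 2 + ∑ j ∈ univ.erase i, ‖⟪g j, g i⟫‖ ^ 2 = ‖g i‖ ^ 2 := by
  have h1 := h.norm_sq (g i)
  rw [← Finset.add_sum_erase _ _ (Finset.mem_univ i)] at h1
  have h2 : ‖⟪g i, g i⟫‖ = ‖g i‖ ^ 2 := by
    rw [gg_inner_self]; simp
  rw [h2] at h1
  exact h1

lemma GGPars.norm_le {g : Fin n → H} (h : GGPars g) (i : Fin n) : ‖g i‖ ≤ 1 := by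
  have h1 := h.sum_sq_index i
  have h2 : 0 ≤ ∑ j ∈ univ.erase i, ‖⟪g j, g i⟫‖ ^ 2 := by positivity
  by_contra! hc
  have h3 : 1 < ‖g i‖ ^ 2 := by nlinarith
  nlinarith

lemma gg_card (f : Fin n → H) [FiniteDimensional ℂ H] (D : Finset (Fin n))
    (hD : ∀ k, k ∉ D → f k ∉ ggW f k.1) : (univ \ D).card ≤ Module.finrank ℂ H := by
  have hne : ∀ k, k ∉ D → InnerProductSpace.gramSchmidt ℂ f k ≠ 0 := by
    intro k hk h0
    apply hD k hk
    have h1 := InnerProductSpace.gramSchmidt_def'' ℂ f k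
    have h2 : f k ∈ Submodule.span ℂ (InnerProductSpace.gramSchmidt ℂ f '' Set.Iio k) := by
      rw [h1, h0, zero_add]
      exact Submodule.sum_mem _ fun i hi => Submodule.smul_mem _ _
        (Submodule.subset_span ⟨i, by simpa using hi, rfl⟩)
    rw [InnerProductSpace.span_gramSchmidt_Iio] at h2
    exact h2
  have hli : LinearIndependent ℂ
      (fun k : {k // k ∈ univ \ D} => InnerProductSpace.gramSchmidt ℂ f k.1) := by
    refine linearIndependent_of_ne_zero_of_inner_eq_zero ?_ ?_
    · rintro ⟨k, hk⟩
      exact hne k (by simpa using hk)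
    · rintro ⟨i, hi⟩ ⟨j, hj⟩ hij
      exact InnerProductSpace.gramSchmidt_orthogonal ℂ f (by simpa using hij)
  have h3 := hli.fintype_card_le_finrank
  rwa [Fintype.card_coe] at h3

lemma GGPars.trace {g : Fin n → H} [FiniteDimensional ℂ H] (h : GGPars g) :
    ∑ i, ‖g i‖ ^ 2 = Module.finrank ℂ H := by
  set b := stdOrthonormalBasis ℂ H
  have h1 : ∀ i, ‖g i‖ ^ 2 = ∑ j, ‖⟪g i, b j⟫‖ ^ 2 := fun i =>
    (b.sum_sq_norm_inner_left (g i)).symm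
  simp only [h1]
  rw [Finset.sum_comm]
  simp [h.norm_sq]

lemma GGPars.onb {g : Fin n → H} [FiniteDimensional ℂ H] (h : GGPars g) (D : Finset (Fin n))
    (hc : (univ \ D).card ≤ Module.finrank ℂ H) (h0 : ∀ k ∈ D, g k = 0) :
    (∀ k, k ∉ D → ‖g k‖ = 1) ∧ ∀ i j, i ≠ j → ⟪g i, g j⟫ = 0 := by
  have hle : ∀ i, ‖g i‖ ^ 2 ≤ 1 := fun i => by
    have := h.norm_le i
    have := norm_nonneg (g i)
    nlinarith
  have hsum : ∑ i ∈ univ \ D, ‖g i‖ ^ 2 = Module.finrank ℂ H := by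
    rw [← h.trace]
    refine Finset.sum_subset (Finset.subset_univ _) fun i _ hi => ?_
    rw [h0 i (by simpa using hi)]; simp
  have hone : ∀ k, k ∉ D → ‖g k‖ = 1 := by
    have hs : ∑ i ∈ univ \ D, (1 - ‖g i‖ ^ 2) = 0 := by
      apply le_antisymm
      · rw [Finset.sum_sub_distrib, hsum]
        simp only [sum_const, nsmul_eq_mul, mul_one, sub_nonpos]
        exact_mod_cast hc
      · exact Finset.sum_nonneg fun i _ => by linarith [hle i]
    rw [Finset.sum_eq_zero_iff_of_nonneg fun i _ => by linarith [hle i]] at hs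
    intro k hk
    have h3 := hs k (by simpa using hk)
    have h4 : ‖g k‖ ^ 2 = 1 := by linarith
    exact (pow_eq_one_iff_of_nonneg (norm_nonneg _) two_ne_zero).1 h4
  refine ⟨hone, fun i j hij => ?_⟩
  by_cases hj : j ∈ D
  · simp [h0 j hj]
  have h5 := h.sum_sq_index j
  rw [hone j hj] at h5
  have h6 : ∑ l ∈ univ.erase j, ‖⟪g l, g j⟫‖ ^ 2 = 0 := by linarith
  rw [Finset.sum_eq_zero_iff_of_nonneg fun i _ => by positivity] at h6
  simpa using h6 i (by simp [hij])

lemma gg_span_of_frame [FiniteDimensional ℂ H] (f : Fin n → H) (hf : IsFrame f) :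
    Submodule.span ℂ (Set.range f) = ⊤ := by
  obtain ⟨A, B, hA, -, h⟩ := hf
  rw [← Submodule.orthogonal_eq_bot_iff, eq_bot_iff]
  intro x hx
  have h1 := (h x).1
  have h2 : ∀ i, ⟪x, f i⟫ = 0 := fun i =>
    (Submodule.mem_orthogonal' _ x).1 hx _ (Submodule.subset_span ⟨i, rfl⟩)
  simp only [h2] at h1
  simp only [norm_zero, ne_eq, OfNat.ofNat_ne_zero, not_false_eq_true, zero_pow,
    sum_const_zero] at h1
  have h3 : ‖x‖ ^ 2 ≤ 0 := by
    by_contra! hc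
    nlinarith [mul_pos hA hc]
  have h4 : ‖x‖ = 0 := by nlinarith [norm_nonneg x]
  simpa using h4

lemma gg_dep_iter (f : Fin n → H) (k : Fin n) (hk : f k ∈ ggW f k.1) (m : ℕ) :
    (GGSP^[m] f) k ∈ ggW (GGSP^[m] f) k.1 ∧ ‖(GGSP^[m] f) k‖ ^ 2 * m ≤ 1 := by
  induction m with
  | zero => exact ⟨hk, by simp⟩
  | succ m ih =>
    rw [Function.iterate_succ_apply']
    have hI := gginv_final (GGSP^[m] f)
    refine ⟨hI.dep k k.2 ih.1, ?_⟩
    have h1 := hI.nrm k k.2 ih.1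
    have h2 := ih.2
    set y := ‖GGSP (GGSP^[m] f) k‖ ^ 2
    set x := ‖(GGSP^[m] f) k‖ ^ 2
    have hy : 0 ≤ y := by positivity
    have hx : 0 ≤ x := by positivity
    have hm : (0 : ℝ) ≤ m := Nat.cast_nonneg m
    push_cast
    -- y (1 + x) ≤ x, x m ≤ 1
    have h3 : y * (m + 1) * (1 + x) ≤ 1 + x := by
      nlinarith [mul_le_mul_of_nonneg_right h1 (by positivity : (0 : ℝ) ≤ m + 1)]
    exact le_of_mul_le_mul_right (by linarith) (by positivity : (0 : ℝ) < 1 + x)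

end GGSPaux

theorem ggsp_iterates_subseq_converges {H : Type*} [NormedAddCommGroup H]
    [InnerProductSpace ℂ H] [FiniteDimensional ℂ H] {n : ℕ} (f : Fin n → H)
    (hf : IsFrame f) :
    ∃ φ : ℕ → ℕ, StrictMono φ ∧ ∃ g : Fin n → H,
      (∀ k, Tendsto (fun m : ℕ => (GGSP^[φ m] f) k) atTop (nhds (g k))) ∧
      IsZeroExtONB (Submodule.span ℂ (Set.range f)) g ∧
      ∀ k, g k = 0 ↔ f k ∈ Submodule.span ℂ (f '' {j : Fin n | j < k}) := by
  classical
  have hspan := gg_span_of_frame f hf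
  have hP : ∀ m : ℕ, GGPars (GGSP^[m + 1] f) := by
    intro m
    induction m with
    | zero => exact gg_pars_of_span f hspan
    | succ m ih =>
      rw [Function.iterate_succ_apply']
      exact gg_pars_of_span _ ih.span
  have : ProperSpace H := FiniteDimensional.proper ℂ H
  have hball : ∀ m : ℕ, GGSP^[m + 1] f ∈ Metric.closedBall (0 : Fin n → H) 1 := by
    intro m
    rw [mem_closedBall_zero_iff, pi_norm_le_iff_of_nonneg zero_le_one]
    exact (hP m).norm_le
  obtain ⟨g, -, ψ, hψ, hlim⟩ :=
    (isCompact_closedBall (0 : Fin n → H) 1).tendsto_subseq hball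
  have hcoord : ∀ k, Tendsto (fun m : ℕ => (GGSP^[ψ m + 1] f) k) atTop (nhds (g k)) :=
    fun k => (tendsto_pi_nhds.1 hlim) k
  have hg : GGPars g := by
    intro x
    have h1 : Tendsto (fun m : ℕ => ∑ i, ⟪(GGSP^[ψ m + 1] f) i, x⟫ • (GGSP^[ψ m + 1] f) i)
        atTop (nhds (∑ i, ⟪g i, x⟫ • g i)) :=
      tendsto_finsetSum _ fun i _ =>
        ((hcoord i).inner tendsto_const_nhds).smul (hcoord i)
    have h2 : (fun m : ℕ => ∑ i, ⟪(GGSP^[ψ m + 1] f) i, x⟫ • (GGSP^[ψ m + 1] f) i)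
        = fun _ => x := funext fun m => hP (ψ m) x
    rw [h2] at h1
    exact tendsto_nhds_unique h1 tendsto_const_nhds
  have h0 : ∀ k, f k ∈ ggW f k.1 → g k = 0 := by
    intro k hk
    have h1 : Tendsto (fun m : ℕ => ‖(GGSP^[ψ m + 1] f) k‖ ^ 2) atTop (nhds (‖g k‖ ^ 2)) :=
      (hcoord k).norm.pow 2
    have h2 : Tendsto (fun m : ℕ => 1 / ((m : ℝ) + 1)) atTop (nhds 0) :=
      tendsto_one_div_add_atTop_nhds_zero_nat
    have h3 : ‖g k‖ ^ 2 ≤ 0 := by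
      refine le_of_tendsto_of_tendsto' h1 h2 fun m => ?_
      have h4 := (gg_dep_iter f k hk (ψ m + 1)).2
      rw [le_div_iff₀ (by positivity)]
      refine le_trans ?_ h4
      push_cast
      have : (m : ℝ) ≤ ψ m := by exact_mod_cast hψ.id_le m
      gcongr
    have h4 : ‖g k‖ = 0 := by nlinarith [norm_nonneg (g k)]
    simpa using h4
  set D : Finset (Fin n) := univ.filter fun k => f k ∈ ggW f k.1 with hD
  have hcard := gg_card f D (by simp [hD])
  obtain ⟨hone, horth⟩ := hg.onb D hcard (by simpa [hD] using h0)
  refine ⟨fun m => ψ m + 1, fun a b hab => Nat.succ_lt_succ (hψ hab), g, hcoord,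
    ⟨?_, horth, by rw [hspan, hg.span]⟩, ?_⟩
  · intro i hi
    apply hone
    intro hm
    exact hi (h0 i (by simpa [hD] using hm))
  · intro k
    refine ⟨fun hk => ?_, h0 k⟩
    by_contra hc
    have h5 := hone k (by
      simp only [hD, Finset.mem_filter, Finset.mem_univ, true_and]
      exact hc)
    rw [hk, norm_zero] at h5
    exact zero_ne_one h5
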